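/- Let H be an a.s. bounded nonempty subset of L⁰(𝓕,B), G a nonempty subset of L⁰(𝓕,B), and x ∈ L⁰(𝓕,B). Then for every A ∈ 𝓕, Ĩ_A · R(H,x) = R(Ĩ_A H, Ĩ_A x) and Ĩ_A · R(H,G) = R(Ĩ_A H, Ĩ_A G), where Ĩ_A H := {Ĩ_A h : h ∈ H}. Moreover, for every sequence (x_n) in L⁰(𝓕,B), every sequence (H_n) of a.s. bounded nonempty subsets of L⁰(𝓕,B), every sequence (G_n) of nonempty subsets of L⁰(𝓕,B), and every countable measurable partition (A_n) of Ω, one has R(Σ_n Ĩ_{A_n}H_n, Σ_n Ĩ_{A_n}x_n) = Σ_n Ĩ_{A_n} R(H_n, x_n) and R(Σ_n Ĩ_{A_n}H_n, Σ_n Ĩ_{A_n}G_n) = Σ_n Ĩ_{A_n} R(H_n, G_n), where Σ_n Ĩ_{A_n}H_n := {Σ_n Ĩ_{A_n} y_n : y_n ∈ H_n for each n}. -/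

import Mathlib

open MeasureTheory Set Filter Function
open scoped Classical

noncomputable section

namespace RNM


variable {Ω : Type*} [MeasurableSpace Ω] {P : Measure Ω}
variable {B : Type*} [NormedAddCommGroup B] [NormedSpace ℝ B]

/-- The pointwise norm of `x ∈ L⁰(𝓕,B)` as an element of `L⁰(𝓕,ℝ)`. -/
def nrm (x : Ω →ₘ[P] B) : Ω →ₘ[P] ℝ := x.comp norm continuous_norm

/-- The module action of `L⁰(𝓕,ℝ)` on `L⁰(𝓕,B)` (pointwise scalar multiplication). -/
def msmul (l : Ω →ₘ[P] ℝ) (x : Ω →ₘ[P] B) : Ω →ₘ[P] B :=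
  AEEqFun.comp₂ (fun c (b : B) => c • b) continuous_smul l x

/-- `Ĩ_A`, the equivalence class of the indicator function of `A`, in `L⁰(𝓕,ℝ)`. -/
def ind (A : Set Ω) (hA : MeasurableSet A) : Ω →ₘ[P] ℝ :=
  AEEqFun.mk (A.indicator fun _ => (1 : ℝ))
    ((measurable_const.indicator hA).aestronglyMeasurable)

/-- A subset of `L⁰(𝓕,B)` is a.s. bounded if the norms of its members have a common
bound in `L⁰(𝓕,ℝ)`. -/
def ASBounded (H : Set (Ω →ₘ[P] B)) : Prop :=
  ∃ ξ : Ω →ₘ[P] ℝ, ∀ h ∈ H, nrm h ≤ ξ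

/-- The supremum of a subset of `L⁰(𝓕,ℝ)` (junk value `0` if no least upper bound exists;
for nonempty a.s. bounded-above sets the least upper bound always exists, by Dedekind
completeness of `L⁰(𝓕,ℝ)`). -/
def lsup (S : Set (Ω →ₘ[P] ℝ)) : Ω →ₘ[P] ℝ :=
  if h : ∃ ξ, IsLUB S ξ then h.choose else 0

/-- The infimum of a subset of `L⁰(𝓕,ℝ)` (junk value `0` if no greatest lower bound exists). -/
def linf (S : Set (Ω →ₘ[P] ℝ)) : Ω →ₘ[P] ℝ :=
  if h : ∃ ξ, IsGLB S ξ then h.choose else 0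

/-- The random Chebyshev radius `R(H,x)` of `H` at `x`. -/
def Rr (H : Set (Ω →ₘ[P] B)) (x : Ω →ₘ[P] B) : Ω →ₘ[P] ℝ :=
  lsup ((fun y => nrm (x - y)) '' H)

/-- The random Chebyshev radius `R(H,G)` of `H` with respect to `G`. -/
def RrS (H G : Set (Ω →ₘ[P] B)) : Ω →ₘ[P] ℝ :=
  linf ((fun x => Rr H x) '' G)

/-- The random Chebyshev center `C(H,G)` of `H` with respect to `G`. -/
def Cc (H G : Set (Ω →ₘ[P] B)) : Set (Ω →ₘ[P] B) :=
  {x ∈ G | Rr H x = RrS H G}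

/-- The random diameter `D(H)`. -/
def Dd (H : Set (Ω →ₘ[P] B)) : Ω →ₘ[P] ℝ :=
  lsup {ξ | ∃ x ∈ H, ∃ y ∈ H, ξ = nrm (x - y)}

/-- A subset of `L⁰(𝓕,B)` is closed if it is sequentially closed under convergence in
probability (the `(ε,λ)`-topology). -/
def SeqClosed (S : Set (Ω →ₘ[P] B)) : Prop :=
  ∀ (x : ℕ → Ω →ₘ[P] B) (y : Ω →ₘ[P] B), (∀ n, x n ∈ S) →
    TendstoInMeasure P (fun n => (x n : Ω → B)) atTop y → y ∈ S

/-- The closure of a subset of `L⁰(𝓕,B)` under convergence in probability. -/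
def seqClosure (S : Set (Ω →ₘ[P] B)) : Set (Ω →ₘ[P] B) :=
  {y | ∃ x : ℕ → Ω →ₘ[P] B, (∀ n, x n ∈ S) ∧
    TendstoInMeasure P (fun n => (x n : Ω → B)) atTop y}

/-- `L⁰`-convexity. -/
def LConvex (G : Set (Ω →ₘ[P] B)) : Prop :=
  ∀ x ∈ G, ∀ y ∈ G, ∀ l : Ω →ₘ[P] ℝ, 0 ≤ l → l ≤ 1 →
    msmul l x + msmul (1 - l) y ∈ G

/-- `L⁰`-convex compactness: `G` is a nonempty closed `L⁰`-convex set such that every family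
of nonempty closed `L⁰`-convex subsets of `G` with the finite intersection property has
nonempty intersection. -/
def ConvexlyCompact (G : Set (Ω →ₘ[P] B)) : Prop :=
  G.Nonempty ∧ SeqClosed G ∧ LConvex G ∧
    ∀ 𝒞 : Set (Set (Ω →ₘ[P] B)),
      (∀ C ∈ 𝒞, C.Nonempty ∧ C ⊆ G ∧ SeqClosed C ∧ LConvex C) →
      (∀ S : Finset (Set (Ω →ₘ[P] B)), ↑S ⊆ 𝒞 → (⋂₀ (S : Set (Set (Ω →ₘ[P] B)))).Nonempty) →
      (⋂₀ 𝒞).Nonempty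

/-- Random normal structure. -/
def RandNormalStructure (G : Set (Ω →ₘ[P] B)) : Prop :=
  ∀ H ⊆ G, H.Nonempty → ASBounded H → SeqClosed H → LConvex H → Dd H ≠ 0 →
    ∃ z ∈ H, ∀ᵐ ω ∂P, 0 < Dd H ω → Rr H z ω < Dd H ω

/-- A nonexpansive mapping (on `G`). -/
def NonexpansiveOn (G : Set (Ω →ₘ[P] B)) (T : (Ω →ₘ[P] B) → (Ω →ₘ[P] B)) : Prop :=
  ∀ x ∈ G, ∀ y ∈ G, nrm (T x - T y) ≤ nrm (x - y)

/-- An isometric mapping (on `G`). -/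
def IsometricOn (G : Set (Ω →ₘ[P] B)) (T : (Ω →ₘ[P] B) → (Ω →ₘ[P] B)) : Prop :=
  ∀ x ∈ G, ∀ y ∈ G, nrm (T x - T y) = nrm (x - y)

/-- A countable measurable partition of `Ω`. -/
def IsPartition (A : ℕ → Set Ω) : Prop :=
  (∀ n, MeasurableSet (A n)) ∧ Pairwise (Disjoint on A) ∧ (⋃ n, A n) = univ

/-- `y` is the countable concatenation `Σ_n Ĩ_{A_n} x_n`,
i.e. `y` agrees a.s. with `x n` on `A n` for each `n`. -/
def IsConcat (A : ℕ → Set Ω) (x : ℕ → Ω →ₘ[P] B) (y : Ω →ₘ[P] B) : Prop :=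
  ∀ n, ∀ᵐ ω ∂P, ω ∈ A n → y ω = x n ω

/-- `G` is σ-stable: it contains all countable concatenations of its members along
countable measurable partitions of `Ω`. -/
def SigmaStable (G : Set (Ω →ₘ[P] B)) : Prop :=
  ∀ A : ℕ → Set Ω, IsPartition A → ∀ x : ℕ → Ω →ₘ[P] B, (∀ n, x n ∈ G) →
    ∀ y, IsConcat A x y → y ∈ G

/-- The σ-stable hull of `G`. -/
def sigmaHull (G : Set (Ω →ₘ[P] B)) : Set (Ω →ₘ[P] B) :=
  {y | ∃ A : ℕ → Set Ω, IsPartition A ∧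
    ∃ x : ℕ → Ω →ₘ[P] B, (∀ n, x n ∈ G) ∧ IsConcat A x y}

/-- The countable concatenation `Σ_n Ĩ_{A_n} H_n` of a sequence of sets. -/
def concatSet (A : ℕ → Set Ω) (H : ℕ → Set (Ω →ₘ[P] B)) : Set (Ω →ₘ[P] B) :=
  {y | ∃ x : ℕ → Ω →ₘ[P] B, (∀ n, x n ∈ H n) ∧ IsConcat A x y}

/-- A finitely stable subset of `L⁰(𝓕,B)`. -/
def FinStable (G : Set (Ω →ₘ[P] B)) : Prop :=
  ∀ x ∈ G, ∀ y ∈ G, ∀ A : Set Ω, ∀ hA : MeasurableSet A,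
    msmul (ind A hA) x + msmul (ind Aᶜ hA.compl) y ∈ G


section Helpers

lemma nrm_coe (x : Ω →ₘ[P] B) : nrm x =ᵐ[P] fun ω => ‖x ω‖ :=
  AEEqFun.coeFn_comp _ _ _

lemma msmul_coe (l : Ω →ₘ[P] ℝ) (x : Ω →ₘ[P] B) :
    msmul l x =ᵐ[P] fun ω => l ω • x ω :=
  AEEqFun.coeFn_comp₂ _ _ _ _

lemma ind_coe (A : Set Ω) (hA : MeasurableSet A) :
    (ind A hA : Ω →ₘ[P] ℝ) =ᵐ[P] A.indicator fun _ => (1 : ℝ) :=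
  AEEqFun.coeFn_mk _ _

lemma le_iff (a b : Ω →ₘ[P] ℝ) : a ≤ b ↔ ∀ᵐ ω ∂P, a ω ≤ b ω :=
  AEEqFun.coeFn_le.symm

/-- Countable suprema exist. -/
lemma exists_lub_seq (f : ℕ → Ω →ₘ[P] ℝ) (ξ : Ω →ₘ[P] ℝ) (h : ∀ n, f n ≤ ξ) :
    ∃ g, IsLUB (range f) g := by
  have hm : AEStronglyMeasurable (fun ω => ⨆ n, f n ω) P :=
    (AEMeasurable.iSup fun n => (f n).aemeasurable).aestronglyMeasurable
  have hb : ∀ᵐ ω ∂P, ∀ n, f n ω ≤ ξ ω := ae_all_iff.2 fun n => (le_iff _ _).1 (h n)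
  refine ⟨AEEqFun.mk _ hm, ?_, ?_⟩
  · rintro _ ⟨n, rfl⟩
    rw [le_iff]
    filter_upwards [hb, AEEqFun.coeFn_mk _ hm] with ω h1 h2
    rw [h2]
    exact le_ciSup (f := fun n => f n ω) ⟨ξ ω, by rintro _ ⟨n, rfl⟩; exact h1 n⟩ n
  · intro u hu
    have hu' : ∀ᵐ ω ∂P, ∀ n, f n ω ≤ u ω :=
      ae_all_iff.2 fun n => (le_iff _ _).1 (hu ⟨n, rfl⟩)
    rw [le_iff]
    filter_upwards [hu', AEEqFun.coeFn_mk _ hm] with ω h1 h2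
    rw [h2]
    exact ciSup_le h1

lemma arctan_integrable [IsProbabilityMeasure P] (f : Ω →ₘ[P] ℝ) :
    Integrable (fun ω => Real.arctan (f ω)) P := by
  refine Integrable.of_bound (C := Real.pi / 2)
    (Real.continuous_arctan.comp_aestronglyMeasurable f.aestronglyMeasurable) ?_
  filter_upwards with ω
  rw [Real.norm_eq_abs, abs_le]
  exact ⟨(Real.neg_pi_div_two_lt_arctan _).le, (Real.arctan_lt_pi_div_two _).le⟩

lemma arctan_int_mono [IsProbabilityMeasure P] {f g : Ω →ₘ[P] ℝ} (h : f ≤ g) :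
    ∫ ω, Real.arctan (f ω) ∂P ≤ ∫ ω, Real.arctan (g ω) ∂P := by
  refine integral_mono_ae (arctan_integrable f) (arctan_integrable g) ?_
  filter_upwards [(le_iff _ _).1 h] with ω h
  exact Real.arctan_strictMono.monotone h

lemma arctan_int_eq [IsProbabilityMeasure P] {f g : Ω →ₘ[P] ℝ} (h : f ≤ g)
    (h' : ∫ ω, Real.arctan (g ω) ∂P ≤ ∫ ω, Real.arctan (f ω) ∂P) : g ≤ f := by
  have h1 : (fun ω => Real.arctan (f ω)) ≤ᵐ[P] fun ω => Real.arctan (g ω) := by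
    filter_upwards [(le_iff _ _).1 h] with ω h
    exact Real.arctan_strictMono.monotone h
  have h2 := (integral_eq_iff_of_ae_le (arctan_integrable f) (arctan_integrable g) h1).1
    (le_antisymm (arctan_int_mono h) h')
  rw [le_iff]
  filter_upwards [h2] with ω h
  exact (Real.arctan_injective h).ge

/-- Dedekind completeness. -/
lemma exists_lub [IsProbabilityMeasure P] (S : Set (Ω →ₘ[P] ℝ)) (hS : S.Nonempty)
    (hb : BddAbove S) : ∃ g, IsLUB S g := by
  obtain ⟨ξ, hξ⟩ := hb
  obtain ⟨s0, hs0⟩ := hS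
  have key : ∀ σ : ℕ → S, ∃ g, IsLUB (range fun n => (σ n : Ω →ₘ[P] ℝ)) g := fun σ =>
    exists_lub_seq _ ξ fun n => hξ (σ n).2
  choose g hg using key
  let φ : (ℕ → S) → ℝ := fun σ => ∫ ω, Real.arctan (g σ ω) ∂P
  have hφb : BddAbove (range φ) := by
    refine ⟨∫ ω, Real.arctan (ξ ω) ∂P, ?_⟩
    rintro _ ⟨σ, rfl⟩
    refine arctan_int_mono ((hg σ).2 ?_)
    rintro _ ⟨n, rfl⟩
    exact hξ (σ n).2
  have : Nonempty (ℕ → S) := ⟨fun _ => ⟨s0, hs0⟩⟩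
  have hseq : ∀ k : ℕ, ∃ σ, (⨆ σ, φ σ) - 1 / ((k : ℝ) + 1) < φ σ := fun k =>
    exists_lt_of_lt_ciSup (by have : (0 : ℝ) < 1 / ((k : ℝ) + 1) := by positivity
                              linarith)
  choose τ hτ using hseq
  let ρ : ℕ → S := fun n => τ n.unpair.1 n.unpair.2
  have hρ : ∀ k, g (τ k) ≤ g ρ := by
    intro k
    refine (hg _).2 ?_
    rintro _ ⟨n, rfl⟩
    refine (hg ρ).1 ⟨Nat.pair k n, ?_⟩
    simp [ρ]
  have hmax : ∀ σ, φ σ ≤ φ ρ := by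
    intro σ
    refine (le_ciSup hφb σ).trans ?_
    have h1 : ∀ k : ℕ, (⨆ σ, φ σ) - 1 / ((k : ℝ) + 1) ≤ φ ρ := fun k =>
      (hτ k).le.trans (arctan_int_mono (hρ k))
    have h2 : Tendsto (fun k : ℕ => (⨆ σ, φ σ) - 1 / ((k : ℝ) + 1)) atTop
        (nhds ((⨆ σ, φ σ) - 0)) :=
      tendsto_const_nhds.sub tendsto_one_div_add_atTop_nhds_zero_nat
    rw [sub_zero] at h2
    exact le_of_tendsto' h2 h1
  refine ⟨g ρ, ?_, ?_⟩
  · intro s hs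
    let ρ' : ℕ → S := fun n => Nat.casesOn n ⟨s, hs⟩ ρ
    have h1 : g ρ ≤ g ρ' := by
      refine (hg _).2 ?_
      rintro _ ⟨n, rfl⟩
      exact (hg ρ').1 ⟨n + 1, rfl⟩
    exact ((hg ρ').1 ⟨0, rfl⟩ : s ≤ g ρ').trans (arctan_int_eq h1 (hmax ρ'))
  · intro u hu
    refine (hg ρ).2 ?_
    rintro _ ⟨n, rfl⟩
    exact hu (ρ n).2

lemma neg_le_neg_L (a b : Ω →ₘ[P] ℝ) (h : a ≤ b) : -b ≤ -a := by
  rw [le_iff] at *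
  filter_upwards [h, AEEqFun.coeFn_neg a, AEEqFun.coeFn_neg b] with ω h1 h2 h3
  rw [h2, h3]
  simpa using h1

lemma exists_glb [IsProbabilityMeasure P] (S : Set (Ω →ₘ[P] ℝ)) (hS : S.Nonempty)
    (hb : BddBelow S) : ∃ g, IsGLB S g := by
  obtain ⟨ξ, hξ⟩ := hb
  obtain ⟨g, hg⟩ := exists_lub ((fun s => -s) '' S) (hS.image _)
    ⟨-ξ, by rintro _ ⟨s, hs, rfl⟩; exact neg_le_neg_L _ _ (hξ hs)⟩
  refine ⟨-g, ?_, ?_⟩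
  · intro s hs
    have := neg_le_neg_L _ _ (hg.1 ⟨s, hs, rfl⟩)
    simpa using this
  · intro u hu
    have : g ≤ -u := hg.2 (by rintro _ ⟨s, hs, rfl⟩; exact neg_le_neg_L _ _ (hu hs))
    simpa using neg_le_neg_L _ _ this

/-- Gluing two elements along a measurable set. -/
lemma exists_piecewise (A : Set Ω) (hA : MeasurableSet A) (a b : Ω →ₘ[P] ℝ) :
    ∃ u : Ω →ₘ[P] ℝ, ∀ᵐ ω ∂P, (ω ∈ A → u ω = a ω) ∧ (ω ∉ A → u ω = b ω) := by
  have hm : AEStronglyMeasurable (A.piecewise a b) P :=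
    AEStronglyMeasurable.piecewise hA a.aestronglyMeasurable.restrict
      b.aestronglyMeasurable.restrict
  refine ⟨AEEqFun.mk _ hm, ?_⟩
  filter_upwards [AEEqFun.coeFn_mk _ hm] with ω h
  rw [h]
  exact ⟨fun h => by simp [h], fun h => by simp [h]⟩

lemma lub_local {S T : Set (Ω →ₘ[P] ℝ)} {a b : Ω →ₘ[P] ℝ} (A : Set Ω) (hA : MeasurableSet A)
    (ha : IsLUB S a) (hb : b ∈ upperBounds T)
    (h : ∀ s ∈ S, ∃ t ∈ T, ∀ᵐ ω ∂P, ω ∈ A → s ω ≤ t ω) :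
    ∀ᵐ ω ∂P, ω ∈ A → a ω ≤ b ω := by
  obtain ⟨u, hu⟩ := exists_piecewise A hA b a
  have : a ≤ u := by
    refine ha.2 fun s hs => ?_
    obtain ⟨t, ht, hst⟩ := h s hs
    rw [le_iff]
    filter_upwards [hu, hst, (le_iff _ _).1 (hb ht), (le_iff _ _).1 (ha.1 hs)] with ω h1 h2 h3 h4
    by_cases hω : ω ∈ A
    · rw [h1.1 hω]; exact (h2 hω).trans h3
    · rw [h1.2 hω]; exact h4
  filter_upwards [hu, (le_iff _ _).1 this] with ω h1 h2 hω
  rw [← h1.1 hω]; exact h2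

lemma glb_local {S T : Set (Ω →ₘ[P] ℝ)} {a b : Ω →ₘ[P] ℝ} (A : Set Ω) (hA : MeasurableSet A)
    (ha : IsGLB S a) (hb : b ∈ lowerBounds T)
    (h : ∀ s ∈ S, ∃ t ∈ T, ∀ᵐ ω ∂P, ω ∈ A → t ω ≤ s ω) :
    ∀ᵐ ω ∂P, ω ∈ A → b ω ≤ a ω := by
  obtain ⟨u, hu⟩ := exists_piecewise A hA b a
  have : u ≤ a := by
    refine ha.2 fun s hs => ?_
    obtain ⟨t, ht, hst⟩ := h s hs
    rw [le_iff]
    filter_upwards [hu, hst, (le_iff _ _).1 (hb ht), (le_iff _ _).1 (ha.1 hs)] with ω h1 h2 h3 h4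
    by_cases hω : ω ∈ A
    · rw [h1.1 hω]; exact h3.trans (h2 hω)
    · rw [h1.2 hω]; exact h4
  filter_upwards [hu, (le_iff _ _).1 this] with ω h1 h2 hω
  rw [← h1.1 hω]; exact h2

lemma Rr_isLUB [IsProbabilityMeasure P] {H : Set (Ω →ₘ[P] B)} (hH : H.Nonempty)
    (hb : ASBounded H) (x : Ω →ₘ[P] B) : IsLUB ((fun y => nrm (x - y)) '' H) (Rr H x) := by
  obtain ⟨ξ, hξ⟩ := hb
  have h : ∃ g, IsLUB ((fun y => nrm (x - y)) '' H) g := by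
    refine exists_lub _ (hH.image _) ⟨nrm x + ξ, ?_⟩
    rintro _ ⟨y, hy, rfl⟩
    rw [le_iff]
    filter_upwards [nrm_coe (x - y), nrm_coe x, nrm_coe y, (le_iff _ _).1 (hξ y hy),
      AEEqFun.coeFn_add (nrm x) ξ, AEEqFun.coeFn_sub x y] with ω h1 h2 h3 h4 h5 h6
    rw [h1, h5, h6, Pi.add_apply, h2, Pi.sub_apply]
    rw [h3] at h4
    exact (norm_sub_le _ _).trans (by linarith)
  unfold Rr lsup
  rw [dif_pos h]
  exact h.choose_spec

lemma Rr_nonneg [IsProbabilityMeasure P] {H : Set (Ω →ₘ[P] B)} (hH : H.Nonempty)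
    (hb : ASBounded H) (x : Ω →ₘ[P] B) : 0 ≤ Rr H x := by
  obtain ⟨y, hy⟩ := hH
  refine le_trans ?_ ((Rr_isLUB ⟨y, hy⟩ hb x).1 ⟨y, hy, rfl⟩)
  rw [le_iff]
  filter_upwards [nrm_coe (x - y), AEEqFun.coeFn_zero (α := Ω) (μ := P) (β := ℝ)] with ω h1 h2
  simp only [h1, h2]
  exact norm_nonneg _

lemma RrS_isGLB [IsProbabilityMeasure P] {H G : Set (Ω →ₘ[P] B)} (hH : H.Nonempty)
    (hb : ASBounded H) (hG : G.Nonempty) : IsGLB ((fun x => Rr H x) '' G) (RrS H G) := by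
  have h : ∃ g, IsGLB ((fun x => Rr H x) '' G) g := by
    refine exists_glb _ (hG.image _) ⟨0, ?_⟩
    rintro _ ⟨y, hy, rfl⟩
    exact Rr_nonneg hH hb y
  unfold RrS linf
  rw [dif_pos h]
  exact h.choose_spec

/-- Every element of `H` agrees on `A` with some element of `H'`. -/
def SubOn (A : Set Ω) (H H' : Set (Ω →ₘ[P] B)) : Prop :=
  ∀ h ∈ H, ∃ h' ∈ H', ∀ᵐ ω ∂P, ω ∈ A → h ω = h' ω

lemma Rr_local_le [IsProbabilityMeasure P] {A : Set Ω} (hA : MeasurableSet A)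
    {H H' : Set (Ω →ₘ[P] B)} (hH : H.Nonempty) (hb : ASBounded H)
    (hH' : H'.Nonempty) (hb' : ASBounded H') (h : SubOn A H H')
    {x x' : Ω →ₘ[P] B} (hx : ∀ᵐ ω ∂P, ω ∈ A → x ω = x' ω) :
    ∀ᵐ ω ∂P, ω ∈ A → Rr H x ω ≤ Rr H' x' ω := by
  refine lub_local A hA (Rr_isLUB hH hb x) (Rr_isLUB hH' hb' x').1 ?_
  rintro _ ⟨y, hy, rfl⟩
  obtain ⟨y', hy', hyy⟩ := h y hy
  refine ⟨_, ⟨y', hy', rfl⟩, ?_⟩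
  filter_upwards [hyy, hx, nrm_coe (x - y), nrm_coe (x' - y'), AEEqFun.coeFn_sub x y,
    AEEqFun.coeFn_sub x' y'] with ω h1 h2 h3 h4 h5 h6 hω
  simp only [h3, h4, h5, h6, Pi.sub_apply, h1 hω, h2 hω, le_refl]

lemma Rr_local [IsProbabilityMeasure P] {A : Set Ω} (hA : MeasurableSet A)
    {H H' : Set (Ω →ₘ[P] B)} (hH : H.Nonempty) (hb : ASBounded H)
    (hH' : H'.Nonempty) (hb' : ASBounded H') (h : SubOn A H H') (h' : SubOn A H' H)
    {x x' : Ω →ₘ[P] B} (hx : ∀ᵐ ω ∂P, ω ∈ A → x ω = x' ω) :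
    ∀ᵐ ω ∂P, ω ∈ A → Rr H x ω = Rr H' x' ω := by
  filter_upwards [Rr_local_le hA hH hb hH' hb' h hx, Rr_local_le hA hH' hb' hH hb h'
    (x := x') (x' := x) (by filter_upwards [hx] with ω h hω using (h hω).symm)] with ω h1 h2 hω
  exact le_antisymm (h1 hω) (h2 hω)

lemma RrS_local_le [IsProbabilityMeasure P] {A : Set Ω} (hA : MeasurableSet A)
    {H H' G G' : Set (Ω →ₘ[P] B)} (hH : H.Nonempty) (hb : ASBounded H)
    (hH' : H'.Nonempty) (hb' : ASBounded H') (h : SubOn A H H') (h' : SubOn A H' H)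
    (hG : G.Nonempty) (hG' : G'.Nonempty) (hGG : SubOn A G G') :
    ∀ᵐ ω ∂P, ω ∈ A → RrS H' G' ω ≤ RrS H G ω := by
  refine glb_local A hA (RrS_isGLB hH hb hG) (RrS_isGLB hH' hb' hG').1 ?_
  rintro _ ⟨y, hy, rfl⟩
  obtain ⟨y', hy', hyy⟩ := hGG y hy
  refine ⟨_, ⟨y', hy', rfl⟩, ?_⟩
  filter_upwards [Rr_local hA hH hb hH' hb' h h' hyy] with ω h hω
  exact (h hω).ge

lemma RrS_local [IsProbabilityMeasure P] {A : Set Ω} (hA : MeasurableSet A)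
    {H H' G G' : Set (Ω →ₘ[P] B)} (hH : H.Nonempty) (hb : ASBounded H)
    (hH' : H'.Nonempty) (hb' : ASBounded H') (h : SubOn A H H') (h' : SubOn A H' H)
    (hG : G.Nonempty) (hG' : G'.Nonempty) (hGG : SubOn A G G') (hGG' : SubOn A G' G) :
    ∀ᵐ ω ∂P, ω ∈ A → RrS H G ω = RrS H' G' ω := by
  filter_upwards [RrS_local_le hA hH hb hH' hb' h h' hG hG' hGG,
    RrS_local_le hA hH' hb' hH hb h' h hG' hG hGG'] with ω h1 h2 hω
  exact le_antisymm (h2 hω) (h1 hω)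

lemma ind_on (A : Set Ω) (hA : MeasurableSet A) (x : Ω →ₘ[P] B) :
    ∀ᵐ ω ∂P, ω ∈ A → msmul (ind A hA) x ω = x ω := by
  filter_upwards [msmul_coe (ind A hA) x, ind_coe (P := P) A hA] with ω h1 h2 hω
  rw [h1, h2]; simp [hω]

lemma ind_off (A : Set Ω) (hA : MeasurableSet A) (x : Ω →ₘ[P] B) :
    ∀ᵐ ω ∂P, ω ∈ Aᶜ → msmul (ind A hA) x ω = (0 : Ω →ₘ[P] B) ω := by
  filter_upwards [msmul_coe (ind A hA) x, ind_coe (P := P) A hA,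
    AEEqFun.coeFn_zero (α := Ω) (μ := P) (β := B)] with ω h1 h2 h3 hω
  rw [h1, h2, h3]; simp [show ω ∉ A from hω]

lemma ASBounded_ind (A : Set Ω) (hA : MeasurableSet A) {H : Set (Ω →ₘ[P] B)}
    (hb : ASBounded H) : ASBounded (msmul (ind A hA) '' H) := by
  obtain ⟨ξ, hξ⟩ := hb
  refine ⟨ξ, ?_⟩
  rintro _ ⟨y, hy, rfl⟩
  rw [le_iff]
  filter_upwards [ind_on A hA y, ind_off A hA y, (le_iff _ _).1 (hξ y hy), nrm_coe y,
    nrm_coe (msmul (ind A hA) y), AEEqFun.coeFn_zero (α := Ω) (μ := P) (β := B)]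
    with ω h1 h2 h3 h4 h5 h6
  rw [h5]
  rw [h4] at h3
  by_cases hω : ω ∈ A
  · rw [h1 hω]; exact h3
  · rw [h2 hω, h6]; simpa using (norm_nonneg _).trans h3

lemma nrm_zero' : nrm (0 : Ω →ₘ[P] B) = 0 := by
  apply AEEqFun.ext
  filter_upwards [nrm_coe (0 : Ω →ₘ[P] B), AEEqFun.coeFn_zero (α := Ω) (μ := P) (β := B),
    AEEqFun.coeFn_zero (α := Ω) (μ := P) (β := ℝ)] with ω h1 h2 h3
  rw [h1, h2, h3]; simp

lemma ASBounded_zero : ASBounded ({0} : Set (Ω →ₘ[P] B)) :=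
  ⟨0, by rintro _ rfl; exact nrm_zero'.le⟩

lemma Rr_zero [IsProbabilityMeasure P] : Rr ({0} : Set (Ω →ₘ[P] B)) 0 = 0 := by
  have h := Rr_isLUB (singleton_nonempty (0 : Ω →ₘ[P] B)) ASBounded_zero 0
  rw [image_singleton, sub_zero, nrm_zero'] at h
  exact h.unique isLUB_singleton

lemma RrS_zero [IsProbabilityMeasure P] : RrS ({0} : Set (Ω →ₘ[P] B)) {0} = 0 := by
  have h := RrS_isGLB (singleton_nonempty (0 : Ω →ₘ[P] B)) ASBounded_zero
    (singleton_nonempty (0 : Ω →ₘ[P] B))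
  rw [image_singleton, Rr_zero] at h
  exact h.unique isGLB_singleton

lemma SubOn_ind (A : Set Ω) (hA : MeasurableSet A) (H : Set (Ω →ₘ[P] B)) :
    SubOn A H (msmul (ind A hA) '' H) := fun h hh =>
  ⟨_, ⟨h, hh, rfl⟩, by filter_upwards [ind_on A hA h] with ω h hω using (h hω).symm⟩

lemma SubOn_ind' (A : Set Ω) (hA : MeasurableSet A) (H : Set (Ω →ₘ[P] B)) :
    SubOn A (msmul (ind A hA) '' H) H := by
  rintro _ ⟨h, hh, rfl⟩
  exact ⟨h, hh, ind_on A hA h⟩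

lemma SubOn_zero (A : Set Ω) (hA : MeasurableSet A) (H : Set (Ω →ₘ[P] B)) :
    SubOn Aᶜ (msmul (ind A hA) '' H) {0} := by
  rintro _ ⟨h, hh, rfl⟩
  exact ⟨0, rfl, ind_off A hA h⟩

lemma SubOn_zero' (A : Set Ω) (hA : MeasurableSet A) {H : Set (Ω →ₘ[P] B)} (hH : H.Nonempty) :
    SubOn Aᶜ {0} (msmul (ind A hA) '' H) := by
  rintro _ rfl
  obtain ⟨h, hh⟩ := hH
  exact ⟨_, ⟨h, hh, rfl⟩, by filter_upwards [ind_off A hA h] with ω h hω using (h hω).symm⟩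

lemma ind_mul_eq (A : Set Ω) (hA : MeasurableSet A) (a b : Ω →ₘ[P] ℝ)
    (h1 : ∀ᵐ ω ∂P, ω ∈ A → a ω = b ω)
    (h2 : ∀ᵐ ω ∂P, ω ∈ Aᶜ → b ω = (0 : Ω →ₘ[P] ℝ) ω) : ind A hA * a = b := by
  apply AEEqFun.ext
  filter_upwards [h1, h2, AEEqFun.coeFn_mul (ind A hA) a, ind_coe (P := P) A hA,
    AEEqFun.coeFn_zero (α := Ω) (μ := P) (β := ℝ)] with ω h1 h2 h3 h4 h5
  rw [h3, Pi.mul_apply, h4]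
  by_cases hω : ω ∈ A
  · simp [hω, h1 hω]
  · rw [h2 hω, h5]; simp [hω]

lemma exists_concat {A : ℕ → Set Ω} (hA : IsPartition A) (x : ℕ → Ω →ₘ[P] B) :
    ∃ y, IsConcat A x y := by
  obtain ⟨hm, hd, hu⟩ := hA
  have hex : ∀ ω, ∃ n, ω ∈ A n := fun ω => by
    have : ω ∈ ⋃ n, A n := hu ▸ mem_univ ω
    simpa using this
  choose i hi using hex
  have hi' : ∀ n ω, ω ∈ A n → i ω = n := by
    intro n ω hω
    by_contra hne
    exact (Set.disjoint_left.1 (hd hne)) (hi ω) hω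
  have hmeas : AEStronglyMeasurable (fun ω => x (i ω) ω) P := by
    suffices h : AEStronglyMeasurable (fun ω => x (i ω) ω) (P.restrict (⋃ n, A n)) by
      rwa [hu, Measure.restrict_univ] at h
    rw [aestronglyMeasurable_iUnion_iff]
    intro n
    refine (x n).aestronglyMeasurable.restrict.congr ?_
    filter_upwards [ae_restrict_mem (hm n)] with ω hω
    rw [hi' n ω hω]
  refine ⟨AEEqFun.mk _ hmeas, fun n => ?_⟩
  filter_upwards [AEEqFun.coeFn_mk _ hmeas] with ω h hω
  rw [h, hi' n ω hω]

lemma concatSet_nonempty {A : ℕ → Set Ω} (hA : IsPartition A) {H : ℕ → Set (Ω →ₘ[P] B)}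
    (hH : ∀ n, (H n).Nonempty) : (concatSet A H).Nonempty := by
  choose x hx using hH
  obtain ⟨y, hy⟩ := exists_concat hA x
  exact ⟨y, x, hx, hy⟩

lemma concatSet_bdd {A : ℕ → Set Ω} (hA : IsPartition A) {H : ℕ → Set (Ω →ₘ[P] B)}
    (hb : ∀ n, ASBounded (H n)) : ASBounded (concatSet A H) := by
  choose ξ hξ using hb
  obtain ⟨η, hη⟩ := exists_concat hA ξ
  refine ⟨η, ?_⟩
  rintro y ⟨x, hx, hy⟩
  rw [le_iff]
  have h1 : ∀ᵐ ω ∂P, ∀ n, ω ∈ A n → η ω = ξ n ω := ae_all_iff.2 hη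
  have h2 : ∀ᵐ ω ∂P, ∀ n, ω ∈ A n → y ω = x n ω := ae_all_iff.2 hy
  have h3 : ∀ᵐ ω ∂P, ∀ n, nrm (x n) ω ≤ ξ n ω :=
    ae_all_iff.2 fun n => (le_iff _ _).1 (hξ n _ (hx n))
  have h4 : ∀ᵐ ω ∂P, ∀ n, nrm (x n) ω = ‖x n ω‖ := ae_all_iff.2 fun n => nrm_coe (x n)
  filter_upwards [h1, h2, h3, h4, nrm_coe y] with ω h1 h2 h3 h4 h5
  have : ω ∈ ⋃ n, A n := hA.2.2 ▸ mem_univ ω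
  obtain ⟨n, hn⟩ := mem_iUnion.1 this
  rw [h5, h1 n hn, h2 n hn, ← h4 n]
  exact h3 n

lemma SubOn_concat (A : ℕ → Set Ω) (H : ℕ → Set (Ω →ₘ[P] B)) (n : ℕ) :
    SubOn (A n) (concatSet A H) (H n) := by
  rintro y ⟨x, hx, hy⟩
  exact ⟨x n, hx n, hy n⟩

lemma SubOn_concat' {A : ℕ → Set Ω} (hA : IsPartition A) {H : ℕ → Set (Ω →ₘ[P] B)}
    (hH : ∀ n, (H n).Nonempty) (n : ℕ) : SubOn (A n) (H n) (concatSet A H) := by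
  intro h hh
  choose x hx using hH
  obtain ⟨y, hy⟩ := exists_concat hA (Function.update x n h)
  refine ⟨y, ⟨_, fun m => ?_, hy⟩, ?_⟩
  · by_cases hm : m = n
    · subst hm; simpa using hh
    · simpa [hm] using hx m
  · filter_upwards [hy n] with ω h hω
    rw [h hω]; simp

end Helpers

/-- `Ĩ_A·R(H,x) = R(Ĩ_A H, Ĩ_A x)`, `Ĩ_A·R(H,G) = R(Ĩ_A H, Ĩ_A G)`, and `R` commutes with
countable concatenations along countable measurable partitions of `Ω`. -/
theorem Rr_indicator_and_concat
    {Ω : Type*} [MeasurableSpace Ω] {P : Measure Ω} [IsProbabilityMeasure P]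
    {B : Type*} [NormedAddCommGroup B] [NormedSpace ℝ B] [CompleteSpace B] :
    (∀ H : Set (Ω →ₘ[P] B), H.Nonempty → ASBounded H →
      ∀ G : Set (Ω →ₘ[P] B), G.Nonempty → ∀ x : Ω →ₘ[P] B,
      ∀ A : Set Ω, ∀ hA : MeasurableSet A,
        ind A hA * Rr H x = Rr (msmul (ind A hA) '' H) (msmul (ind A hA) x) ∧
        ind A hA * RrS H G = RrS (msmul (ind A hA) '' H) (msmul (ind A hA) '' G)) ∧
    (∀ A : ℕ → Set Ω, IsPartition A →
      ∀ H : ℕ → Set (Ω →ₘ[P] B), (∀ n, (H n).Nonempty) → (∀ n, ASBounded (H n)) →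
      ∀ x : ℕ → Ω →ₘ[P] B, ∀ y : Ω →ₘ[P] B, IsConcat A x y →
        IsConcat A (fun n => Rr (H n) (x n)) (Rr (concatSet A H) y)) ∧
    (∀ A : ℕ → Set Ω, IsPartition A →
      ∀ H : ℕ → Set (Ω →ₘ[P] B), (∀ n, (H n).Nonempty) → (∀ n, ASBounded (H n)) →
      ∀ G : ℕ → Set (Ω →ₘ[P] B), (∀ n, (G n).Nonempty) →
        IsConcat A (fun n => RrS (H n) (G n)) (RrS (concatSet A H) (concatSet A G))) := by
  refine ⟨?_, ?_, ?_⟩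
  · intro H hH hb G hG x A hA
    have hb' := ASBounded_ind A hA hb
    constructor
    · refine ind_mul_eq A hA _ _ ?_ ?_
      · refine Rr_local hA hH hb (hH.image _) hb' (SubOn_ind A hA H) (SubOn_ind' A hA H) ?_
        filter_upwards [ind_on A hA x] with ω h hω using (h hω).symm
      · rw [← Rr_zero (B := B)]
        exact Rr_local hA.compl (hH.image _) hb' (singleton_nonempty 0) ASBounded_zero
          (SubOn_zero A hA H) (SubOn_zero' A hA hH) (ind_off A hA x)
    · refine ind_mul_eq A hA _ _ ?_ ?_
      · exact RrS_local hA hH hb (hH.image _) hb' (SubOn_ind A hA H) (SubOn_ind' A hA H)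
          hG (hG.image _) (SubOn_ind A hA G) (SubOn_ind' A hA G)
      · rw [← RrS_zero (B := B)]
        exact RrS_local hA.compl (hH.image _) hb' (singleton_nonempty 0) ASBounded_zero
          (SubOn_zero A hA H) (SubOn_zero' A hA hH) (hG.image _) (singleton_nonempty 0)
          (SubOn_zero A hA G) (SubOn_zero' A hA hG)
  · intro A hA H hH hb x y hy n
    exact Rr_local (hA.1 n) (concatSet_nonempty hA hH) (concatSet_bdd hA hb) (hH n) (hb n)
      (SubOn_concat A H n) (SubOn_concat' hA hH n) (hy n)
  · intro A hA H hH hb G hG n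
    exact RrS_local (hA.1 n) (concatSet_nonempty hA hH) (concatSet_bdd hA hb) (hH n) (hb n)
      (SubOn_concat A H n) (SubOn_concat' hA hH n) (concatSet_nonempty hA hG) (hG n)
      (SubOn_concat A G n) (SubOn_concat' hA hG n)


end RNM
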